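/- Conservation laws for closed Gaussian charge-conserving dynamics (Eq. (57) and Eq. (62)): Let Q be a (2n×2n) real symmetric matrix commuting with Ω_n, with spectral projectors Π_q for q ∈ ℝ. Let V be a symplectic matrix commuting with Ω_n * Q. Then for every (2n×2n) real matrix σ, every real q > 0 and every natural number k: trace(((V·σ·Vᵀ) * (Π_q − Π_{−q}))^k) = trace((σ * (Π_q − Π_{−q}))^k), and trace(((V·σ·Vᵀ) * Ω_n * Π₀)^k) = trace((σ * Ω_n * Π₀)^k). -/

import Mathlib

open Matrix

noncomputable section

/-- The 2×2 standard symplectic form `Ω₁ = !![0,1; -1,0]`. -/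
def Omega1 : Matrix (Fin 2) (Fin 2) ℝ := !![0, 1; -1, 0]

/-- The 2n×2n standard symplectic form `Ω_n`, a block-diagonal matrix with `n` copies of `Ω₁`. -/
def OmegaN (n : ℕ) : Matrix (Fin 2 × Fin n) (Fin 2 × Fin n) ℝ :=
  Matrix.blockDiagonal fun _ => Omega1

/-- A real 2n×2n matrix is symplectic if `S * Ω_n * Sᵀ = Ω_n`. -/
def IsSymplectic {n : ℕ} (S : Matrix (Fin 2 × Fin n) (Fin 2 × Fin n) ℝ) : Prop :=
  S * OmegaN n * Sᵀ = OmegaN n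

lemma aux_OmegaN_sq (n : ℕ) : OmegaN n * OmegaN n = -1 := by
  have h1 : Omega1 * Omega1 = -1 := by
    ext i j
    fin_cases i <;> fin_cases j <;> simp [Omega1, Matrix.mul_apply, Fin.sum_univ_two]
  unfold OmegaN
  rw [← Matrix.blockDiagonal_mul]
  simp only [h1]
  have h2 : (fun _ : Fin n => (-1 : Matrix (Fin 2) (Fin 2) ℝ)) = -1 := by
    funext i
    rfl
  rw [h2, Matrix.blockDiagonal_neg, Matrix.blockDiagonal_one]

lemma aux_OmegaN_transpose (n : ℕ) : (OmegaN n)ᵀ = -OmegaN n := by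
  have h1 : Omega1ᵀ = -Omega1 := by
    ext i j
    fin_cases i <;> fin_cases j <;> simp [Omega1]
  unfold OmegaN
  rw [Matrix.blockDiagonal_transpose]
  simp only [h1]
  rw [← Matrix.blockDiagonal_neg]
  rfl

lemma aux_trace_pow {m : Type*} [Fintype m] [DecidableEq m] (A B : Matrix m m ℝ) (k : ℕ) :
    ((A * B) ^ k).trace = ((B * A) ^ k).trace := by
  cases k with
  | zero => simp
  | succ k =>
    have h : ∀ j : ℕ, (A * B) ^ j * A = A * (B * A) ^ j := by
      intro j
      induction j with
      | zero => simp
      | succ j ih => rw [pow_succ', Matrix.mul_assoc, ih, pow_succ']; simp only [Matrix.mul_assoc]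
    rw [pow_succ, ← Matrix.mul_assoc, h, Matrix.mul_assoc, Matrix.trace_mul_comm,
      Matrix.mul_assoc, ← pow_succ]

lemma aux_full {m : Type*} [Fintype m] [DecidableEq m] (Q P : Matrix m m ℝ) (q : ℝ)
    (h : ∀ v : m → ℝ, Q.mulVec v = q • v → P.mulVec v = v) (X : Matrix m m ℝ)
    (hX : Q * X = q • X) : P * X = X := by
  ext i j
  have h1 : Q.mulVec (X.col j) = q • X.col j := by
    funext a
    exact congrFun (congrFun hX a) j
  exact congrFun (h _ h1) i

/-- Invariance of the range of `P q + P (-q)`. -/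
lemma aux_E {m : Type*} [Fintype m] [DecidableEq m] (Q P N : Matrix m m ℝ) (q : ℝ) (hq : 0 < q)
    (hQ : Q.IsSymm) (hP : P.IsSymm)
    (hPe : Q * P = q • P) (hNe : Q * N = (-q) • N)
    (hPf : ∀ X : Matrix m m ℝ, Q * X = q • X → P * X = X)
    (hNf : ∀ X : Matrix m m ℝ, Q * X = (-q) • X → N * X = X)
    (hN : N.IsSymm)
    (W : Matrix m m ℝ) (hW : W * (Q * Q) = Q * Q * W) :
    (P + N) * (W * (P + N)) = W * (P + N) := by
  have hPQ : P * Q = q • P := by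
    have := congrArg Matrix.transpose hPe
    simpa [Matrix.transpose_mul, hQ.eq, hP.eq] using this
  have hNQ : N * Q = (-q) • N := by
    have := congrArg Matrix.transpose hNe
    simpa [Matrix.transpose_mul, hQ.eq, hN.eq] using this
  have hPN : ∀ X, P * X = X → N * X = 0 := by
    intro X hX
    have h1 : (-q) • (N * X) = q • (N * X) := by
      calc (-q) • (N * X) = N * Q * X := by rw [hNQ, Matrix.smul_mul]
        _ = N * (Q * P * X) := by rw [Matrix.mul_assoc Q, hX, Matrix.mul_assoc]
        _ = q • (N * X) := by rw [hPe, Matrix.smul_mul, hX, Matrix.mul_smul]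
    have h2 : (2 * q) • (N * X) = 0 := by
      rw [two_mul, add_smul]; nth_rewrite 1 [← h1]; rw [neg_smul]; simp
    exact (smul_eq_zero.mp h2).resolve_left (by positivity)
  have hNP : ∀ X, N * X = X → P * X = 0 := by
    intro X hX
    have h1 : q • (P * X) = (-q) • (P * X) := by
      calc q • (P * X) = P * Q * X := by rw [hPQ, Matrix.smul_mul]
        _ = P * (Q * N * X) := by rw [Matrix.mul_assoc Q, hX, Matrix.mul_assoc]
        _ = (-q) • (P * X) := by rw [hNe, Matrix.smul_mul, hX, Matrix.mul_smul]
    have h2 : (2 * q) • (P * X) = 0 := by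
      rw [two_mul, add_smul]; nth_rewrite 1 [h1]; rw [neg_smul]; simp
    exact (smul_eq_zero.mp h2).resolve_left (by positivity)
  have hQQE : Q * Q * (P + N) = (q * q) • (P + N) := by
    rw [Matrix.mul_assoc, Matrix.mul_add, hPe, hNe, Matrix.mul_add, Matrix.mul_smul,
      Matrix.mul_smul, hPe, hNe, smul_smul, smul_smul, neg_mul_neg, smul_add]
  generalize hX : W * (P + N) = X
  have hQQX : Q * (Q * X) = (q * q) • X := by
    rw [← Matrix.mul_assoc, ← hX, ← Matrix.mul_assoc, ← hW, Matrix.mul_assoc, hQQE,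
      Matrix.mul_smul]
  have hY := hPf (Q * X + q • X) (by
    rw [Matrix.mul_add, hQQX, Matrix.mul_smul, smul_add, smul_smul, add_comm])
  have hZ := hNf (Q * X - q • X) (by
    rw [Matrix.mul_sub, hQQX, Matrix.mul_smul, smul_sub, smul_smul, neg_smul, neg_mul, neg_smul]
    abel)
  have hY' := hPN _ hY
  have hZ' := hNP _ hZ
  have hd : (2 * q) • X = (Q * X + q • X) - (Q * X - q • X) := by
    rw [two_mul, add_smul]; abel
  have hfin : (2 * q) • ((P + N) * X) = (2 * q) • X := by
    rw [← Matrix.mul_smul, hd, Matrix.mul_sub, Matrix.add_mul, Matrix.add_mul P N (_ - _),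
      hY, hZ, hY', hZ']
    abel
  exact smul_right_injective _ (by positivity : (2 * q) ≠ 0) hfin

/-- Conservation laws for closed Gaussian charge-conserving dynamics (Eqs. (57) and (62)):
for `Q` real symmetric commuting with `Ω_n`, with spectral projectors `P q`, and a
symplectic `V` commuting with `Ω_n * Q`, the traces of powers of `σ (Π_q − Π_{−q})`
(for `q > 0`) and of `σ Ω_n Π₀` are invariant under `σ ↦ V σ Vᵀ`. -/
theorem closed_gaussian_conservation (n : ℕ)
    (Q : Matrix (Fin 2 × Fin n) (Fin 2 × Fin n) ℝ)
    (P : ℝ → Matrix (Fin 2 × Fin n) (Fin 2 × Fin n) ℝ)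
    (hQsymm : Q.IsSymm) (hQOmega : Q * OmegaN n = OmegaN n * Q)
    (hPsymm : ∀ q, (P q).IsSymm)
    (hPidem : ∀ q, P q * P q = P q)
    (hPeig : ∀ q, Q * P q = q • P q)
    (hPfull : ∀ (q : ℝ) (v : Fin 2 × Fin n → ℝ), Q.mulVec v = q • v → (P q).mulVec v = v)
    (V : Matrix (Fin 2 × Fin n) (Fin 2 × Fin n) ℝ)
    (hV : IsSymplectic V)
    (hVcomm : V * (OmegaN n * Q) = (OmegaN n * Q) * V)
    (σ : Matrix (Fin 2 × Fin n) (Fin 2 × Fin n) ℝ)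
    (q : ℝ) (hq : 0 < q) (k : ℕ) :
    (((V * σ * Vᵀ) * (P q - P (-q))) ^ k).trace = ((σ * (P q - P (-q))) ^ k).trace ∧
    (((V * σ * Vᵀ) * OmegaN n * P 0) ^ k).trace = ((σ * OmegaN n * P 0) ^ k).trace := by
  have hO2 := aux_OmegaN_sq n
  have hOt := aux_OmegaN_transpose n
  unfold IsSymplectic at hV
  generalize OmegaN n = Ω at *
  have hOO : ∀ X, Ω * (Ω * X) = -X := by
    intro X
    rw [← Matrix.mul_assoc, hO2, neg_one_mul]
  have hV' : Vᵀ * (Ω * V) = Ω := by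
    have h1 : V * (-(Ω * Vᵀ * Ω)) = 1 := by
      rw [Matrix.mul_neg, ← Matrix.mul_assoc, ← Matrix.mul_assoc, hV, hO2, neg_neg]
    have h2 := mul_eq_one_comm.mp h1
    have h3 := congrArg (fun X => Ω * X) h2
    simp only [Matrix.neg_mul, Matrix.mul_neg, Matrix.mul_assoc, hOO, neg_neg,
      Matrix.mul_one] at h3
    exact h3
  have hA2 : (Ω * Q) * (Ω * Q) = -(Q * Q) := by
    rw [Matrix.mul_assoc, ← Matrix.mul_assoc Q, hQOmega, Matrix.mul_assoc, hOO]
  have hVtcomm : Vᵀ * (Ω * Q) = (Ω * Q) * Vᵀ := by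
    have := congrArg Matrix.transpose hVcomm
    simp only [Matrix.transpose_mul, hOt, hQsymm.eq, Matrix.mul_neg, Matrix.neg_mul,
      hQOmega, neg_inj] at this
    exact this.symm
  have hQ2 : ∀ W, W * (Ω * Q) = (Ω * Q) * W → W * (Q * Q) = Q * Q * W := by
    intro W hW
    rw [← neg_inj, ← Matrix.mul_neg, ← Matrix.neg_mul (Q * Q), ← hA2, ← Matrix.mul_assoc, hW,
      Matrix.mul_assoc, hW, Matrix.mul_assoc (Ω * Q)]
  have hfull := fun q => aux_full Q (P q) q (hPfull q)
  have hinv := aux_E Q (P q) (P (-q)) q hq hQsymm (hPsymm q) (hPeig q) (hPeig (-q))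
    (hfull q) (hfull (-q)) (hPsymm (-q))
  have hE : V * (P q + P (-q)) = (P q + P (-q)) * V := by
    have h1 := hinv V (hQ2 V hVcomm)
    have h2 := congrArg Matrix.transpose (hinv Vᵀ (hQ2 _ hVtcomm))
    simp only [Matrix.transpose_mul, Matrix.transpose_add, Matrix.transpose_transpose,
      (hPsymm q).eq, (hPsymm (-q)).eq] at h2
    rw [← h1, ← h2, Matrix.mul_assoc]
  have hinv0 : ∀ W, W * (Ω * Q) = (Ω * Q) * W → P 0 * (W * P 0) = W * P 0 := by
    intro W hW
    apply hfull 0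
    have h1 : Ω * (Q * (W * P 0)) = 0 := by
      rw [← Matrix.mul_assoc, ← Matrix.mul_assoc, ← hW, Matrix.mul_assoc, Matrix.mul_assoc, hPeig]
      simp
    have h2 := hOO (Q * (W * P 0))
    rw [h1, Matrix.mul_zero] at h2
    rw [zero_smul]
    exact neg_eq_zero.mp h2.symm
  have h0 : V * P 0 = P 0 * V := by
    have h1 := hinv0 V hVcomm
    have h2 := congrArg Matrix.transpose (hinv0 Vᵀ hVtcomm)
    simp only [Matrix.transpose_mul, Matrix.transpose_transpose, (hPsymm 0).eq] at h2
    rw [← h1, ← h2, Matrix.mul_assoc]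
  have hM : Vᵀ * ((P q - P (-q)) * V) = P q - P (-q) := by
    have hQE : Q * (P q + P (-q)) = q • (P q - P (-q)) := by
      rw [Matrix.mul_add, hPeig, hPeig, neg_smul, smul_sub, sub_eq_add_neg]
    have h1 : q • (Ω * (P q - P (-q)) * V) = q • (V * (Ω * (P q - P (-q)))) := by
      rw [← Matrix.smul_mul, ← Matrix.mul_smul, ← Matrix.mul_smul, ← Matrix.mul_smul, ← hQE,
        ← Matrix.mul_assoc Ω, Matrix.mul_assoc, ← hE, ← Matrix.mul_assoc, ← hVcomm,
        Matrix.mul_assoc]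
    have h2 := smul_right_injective _ hq.ne' h1
    have h3 := hOO ((P q - P (-q)) * V)
    rw [← Matrix.mul_assoc Ω (P q - P (-q)), h2] at h3
    rw [← neg_inj, ← Matrix.mul_neg, ← h3, ← Matrix.mul_assoc Ω V, ← Matrix.mul_assoc Vᵀ, hV',
      hOO]
  constructor
  · rw [Matrix.mul_assoc, Matrix.mul_assoc, aux_trace_pow]
    rw [Matrix.mul_assoc, Matrix.mul_assoc, hM]
  · rw [Matrix.mul_assoc, Matrix.mul_assoc, Matrix.mul_assoc, aux_trace_pow]
    rw [Matrix.mul_assoc, Matrix.mul_assoc, Matrix.mul_assoc, ← h0, ← Matrix.mul_assoc Ω V,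
      ← Matrix.mul_assoc Vᵀ, hV', Matrix.mul_assoc]
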